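/- arXiv:1304.5048 — 2 statements merged into one kernel-verified Lean document; each statement's English description precedes it below -/
import Mathlib

section
/- Suppose 𝐅 = ωF is a distribution in Λ'_{q,l} for some q>0 and integer l≥0, such that the infinite matrices 𝔓(F) and 𝔎(F) have rank at most N. Then for all sufficiently large t, the Toeplitz operator T(F_t) of the scaled symbol F_t is bounded on the Fock space 𝓑 and has rank at most N, i.e., there exist f_1,…,f_N, g_1,…,g_N ∈ 𝓑 with (T(F_t)u, v) = Σ_{j=1}^N (u,g_j)(f_j,v) for all u,v ∈ 𝓑. -/
open MeasureTheory Filter Complex Metric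

noncomputable section

/-- The Gaussian weight `ω(z) = π⁻¹ exp (-|z|²)`. -/
def omegaW (z : ℂ) : ℝ := Real.pi⁻¹ * Real.exp (-‖z‖ ^ 2)

/-- Membership in the weighted space `Λ_{q,l}`: `C^l`-smooth functions whose
derivatives up to order `l` are `o(exp (q|z|²))` at infinity. -/
def MemLambda (q : ℝ) (l : ℕ) (ψ : ℂ → ℂ) : Prop :=
  ContDiff ℝ (l : ℕ∞) ψ ∧
    ∀ n : ℕ, n ≤ l →
      Tendsto (fun z : ℂ => ‖iteratedFDeriv ℝ n ψ z‖ * Real.exp (-q * ‖z‖ ^ 2))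
        (cocompact ℂ) (nhds 0)

/-- The norm of `Λ_{q,l}`. -/
def lambdaNorm (q : ℝ) (l : ℕ) (ψ : ℂ → ℂ) : ℝ :=
  sSup {r : ℝ | ∃ n ≤ l, ∃ z : ℂ, r = ‖iteratedFDeriv ℝ n ψ z‖ * Real.exp (-q * ‖z‖ ^ 2)}

/-- Distributions on `ℂ`, encoded by their pairing against test functions
(with respect to Lebesgue measure). -/
abbrev Dst : Type := (ℂ → ℂ) → ℂ

/-- Membership in the dual space `Λ'_{q,l}`. -/
def MemLambdaDual (q : ℝ) (l : ℕ) (T : Dst) : Prop :=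
  (∀ ψ φ, MemLambda q l ψ → MemLambda q l φ → T (ψ + φ) = T ψ + T φ) ∧
  (∀ (c : ℂ) (ψ), MemLambda q l ψ → T (c • ψ) = c * T ψ) ∧
  (∃ C : ℝ, ∀ ψ, MemLambda q l ψ → ‖T ψ‖ ≤ C * lambdaNorm q l ψ)

/-- The dual norm on `Λ'_{q,l}`. -/
def lambdaDualNorm (q : ℝ) (l : ℕ) (T : Dst) : ℝ :=
  sInf {C : ℝ | 0 ≤ C ∧ ∀ ψ, MemLambda q l ψ → ‖T ψ‖ ≤ C * lambdaNorm q l ψ}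

/-- `∂̄ = (∂/∂x + i ∂/∂y)/2` of a function. -/
def dbarFun (ψ : ℂ → ℂ) : ℂ → ℂ := fun z =>
  (fderiv ℝ ψ z 1 + Complex.I * fderiv ℝ ψ z Complex.I) / 2

/-- Membership in `𝔇_q`: smooth functions all of whose derivatives are
`o(exp (q|z|²))`. -/
def MemDq (q : ℝ) (ψ : ℂ → ℂ) : Prop :=
  ContDiff ℝ (⊤ : ℕ∞) ψ ∧
    ∀ n : ℕ,
      Tendsto (fun z : ℂ => ‖iteratedFDeriv ℝ n ψ z‖ * Real.exp (-q * ‖z‖ ^ 2))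
        (cocompact ℂ) (nhds 0)

/-- Membership in the dual space `𝔇'_q`; every such distribution has finite
order, i.e. is bounded by some `Λ_{q,l}`-norm. -/
def MemDqDual (q : ℝ) (T : Dst) : Prop :=
  (∀ ψ φ, MemDq q ψ → MemDq q φ → T (ψ + φ) = T ψ + T φ) ∧
  (∀ (c : ℂ) (ψ), MemDq q ψ → T (c • ψ) = c * T ψ) ∧
  (∃ (l : ℕ) (C : ℝ), ∀ ψ, MemDq q ψ → ‖T ψ‖ ≤ C * lambdaNorm q l ψ)

/-- Membership in the Fock space `𝓑`: entire and square integrable against `ω dλ`. -/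
def MemFock (u : ℂ → ℂ) : Prop :=
  Differentiable ℂ u ∧ Integrable (fun z : ℂ => ‖u z‖ ^ 2 * omegaW z)

/-- The Fock norm. -/
def fockNorm (u : ℂ → ℂ) : ℝ := Real.sqrt (∫ z : ℂ, ‖u z‖ ^ 2 * omegaW z)

/-- The Fock (weighted `L²`) inner product `(u,v) = ∫ u v̄ ω dλ`. -/
def fockInner (u v : ℂ → ℂ) : ℂ := ∫ z : ℂ, u z * (starRingEnd ℂ) (v z) * (omegaW z : ℂ)

/-- The reproducing kernel `κ_z(w) = exp (w z̄)`. -/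
def repKer (z : ℂ) : ℂ → ℂ := fun w => Complex.exp (w * (starRingEnd ℂ) z)

/-- The Toeplitz sesquilinear form `𝐭_F(u,v) = ⟨ωF, u v̄⟩`, expressed through the
distribution `T = 𝐅 = ωF`. -/
def toeplitzForm (T : Dst) (u v : ℂ → ℂ) : ℂ := T fun z => u z * (starRingEnd ℂ) (v z)

/-- An infinite matrix has rank at most `N` iff every finite submatrix does. -/
def InfRankLE (A : ℕ → ℕ → ℂ) (N : ℕ) : Prop :=
  ∀ (m : ℕ) (r c : Fin m → ℕ), (Matrix.of fun i j : Fin m => A (r i) (c j)).rank ≤ N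

/-- The matrix `𝔓(F)` with entries `𝐭_F(z^k, z^{k'})`. -/
def matP (T : Dst) : ℕ → ℕ → ℂ :=
  fun k k' => toeplitzForm T (fun z => z ^ k) (fun z => z ^ k')

/-- The matrix `𝔎(F)` attached to a sequence of points, with entries
`𝐭_F(κ_{z_k}, κ_{z_{k'}})`. -/
def matK (T : Dst) (zs : ℕ → ℂ) : ℕ → ℕ → ℂ :=
  fun k k' => toeplitzForm T (repKer (zs k)) (repKer (zs k'))

/-- The scaling `S_t ψ (z) = t ψ(tz)`. -/
def scaleS (t : ℝ) (ψ : ℂ → ℂ) : ℂ → ℂ := fun z => (t : ℂ) * ψ ((t : ℂ) * z)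

/-- The scaling `W_t` on distributions, `⟨W_t 𝐅, ψ⟩ = ⟨𝐅, S_{t⁻¹} ψ⟩`. -/
def scaleW (t : ℝ) (T : Dst) : Dst := fun ψ => T (scaleS t⁻¹ ψ)

lemma InfRankLE.exists_skeleton {A : ℕ → ℕ → ℂ} {N : ℕ} (hA : InfRankLE A N) :
    ∃ r ≤ N, ∃ R C : Fin r → ℕ, ∃ M : Matrix (Fin r) (Fin r) ℂ,
      ∀ k k', A k k' = ∑ j, A k (C j) * ∑ i, M j i * A (R i) k' := by
  classical
  let P : ℕ → Prop := fun r =>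
    ∃ R C : Fin r → ℕ, (Matrix.of fun i j : Fin r => A (R i) (C j)).det ≠ 0
  have hbd : ∀ r, P r → r ≤ N := by
    rintro r ⟨R, C, h⟩
    have h1 := Matrix.rank_of_isUnit _ ((Matrix.isUnit_iff_isUnit_det _).2 (isUnit_iff_ne_zero.2 h))
    have h2 := hA r R C
    rw [h1] at h2
    simpa using h2
  have h0 : P 0 := ⟨Fin.elim0, Fin.elim0, by simp⟩
  have hr : P (Nat.findGreatest P N) := Nat.findGreatest_spec (Nat.zero_le N) h0
  have hmax : ¬ P (Nat.findGreatest P N + 1) := fun h => by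
    have := Nat.le_findGreatest (hbd _ h) h
    omega
  generalize Nat.findGreatest P N = r at hr hmax
  have hrN := hbd r hr
  obtain ⟨R, C, hdet⟩ := hr
  set B : Matrix (Fin r) (Fin r) ℂ := Matrix.of fun i j : Fin r => A (R i) (C j) with hB
  let _ : Invertible B := B.invertibleOfIsUnitDet (isUnit_iff_ne_zero.2 hdet)
  refine ⟨r, hrN, R, C, ⅟B, fun k k' => ?_⟩
  have hzero : (Matrix.of fun i j : Fin (r + 1) =>
      A (Fin.snoc (α := fun _ => ℕ) R k i) (Fin.snoc (α := fun _ => ℕ) C k' j)).det = 0 := by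
    by_contra h
    exact hmax ⟨_, _, h⟩
  have key := Matrix.det_fromBlocks₁₁ B (Matrix.of fun i (_ : Fin 1) => A (R i) k')
    (Matrix.of fun (_ : Fin 1) j => A k (C j)) (Matrix.of fun (_ _ : Fin 1) => A k k')
  rw [← Matrix.det_submatrix_equiv_self finSumFinEquiv] at hzero
  have heq : (Matrix.of fun i j : Fin (r + 1) =>
      A (Fin.snoc (α := fun _ => ℕ) R k i) (Fin.snoc (α := fun _ => ℕ) C k' j)).submatrix
        finSumFinEquiv finSumFinEquiv =
      Matrix.fromBlocks B (Matrix.of fun i (_ : Fin 1) => A (R i) k')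
        (Matrix.of fun (_ : Fin 1) j => A k (C j)) (Matrix.of fun (_ _ : Fin 1) => A k k') := by
    have hl : ∀ a : Fin 1, Fin.natAdd r a = Fin.last r := fun a => by
      ext; simp
    have hc : ∀ a : Fin r, Fin.castAdd 1 a = a.castSucc := fun a => rfl
    ext i j
    rcases i with i | i <;> rcases j with j | j <;>
      simp [hB, hl, hc, Fin.snoc_castSucc]
  rw [heq, key, mul_eq_zero] at hzero
  have h := hzero.resolve_left hdet
  rw [Matrix.det_fin_one, Matrix.sub_apply, sub_eq_zero, Matrix.mul_assoc, Matrix.mul_apply] at h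
  simpa [Matrix.mul_apply] using h

open scoped Real in
lemma integral_eq_zero_of_circle_integral_eq_zero {h : ℂ → ℂ} (hc : Continuous h)
    (hi : Integrable h)
    (h0 : ∀ r : ℝ, 0 < r → ∫ θ in (0 : ℝ)..(2 * π), h (circleMap 0 r θ) = 0) :
    ∫ z, h z = 0 := by
  have hsymm : ∀ p : ℝ × ℝ, Complex.polarCoord.symm p = circleMap 0 p.1 p.2 := by
    intro p
    rw [Complex.polarCoord_symm_apply, circleMap, Complex.exp_mul_I]
    simp
  have hcont : Continuous fun p : ℝ × ℝ => p.1 • h (Complex.polarCoord.symm p) := by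
    simp_rw [hsymm, circleMap]
    fun_prop
  rw [← Complex.integral_comp_polarCoord_symm]
  have hint : IntegrableOn (fun p : ℝ × ℝ => p.1 • h (Complex.polarCoord.symm p))
      polarCoord.target := by
    refine ⟨hcont.aestronglyMeasurable, ?_⟩
    have h1 := hi.2
    rw [hasFiniteIntegral_iff_enorm, ← Complex.lintegral_comp_polarCoord_symm] at h1
    rw [hasFiniteIntegral_iff_enorm]
    convert h1 using 1
    refine setLIntegral_congr_fun polarCoord.open_target.measurableSet fun p hp => ?_
    have hp1 : 0 < p.1 := hp.1
    simp only [enorm_smul, smul_eq_mul]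
    rw [Real.enorm_of_nonneg hp1.le]
  have htarget : polarCoord.target = Set.Ioi (0 : ℝ) ×ˢ Set.Ioo (-π) π := rfl
  rw [htarget] at hint ⊢
  rw [Measure.volume_eq_prod] at hint ⊢
  rw [setIntegral_prod _ hint]
  refine setIntegral_eq_zero_of_forall_eq_zero fun r hr => ?_
  have hr' : (0 : ℝ) < r := hr
  simp_rw [hsymm]
  rw [integral_smul, ← integral_Ioc_eq_integral_Ioo,
    ← intervalIntegral.integral_of_le (by linarith [Real.pi_pos])]
  have hper : Function.Periodic (fun θ => h (circleMap 0 r θ)) (2 * π) := fun θ => by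
    simp only [periodic_circleMap 0 r θ]
  have := hper.intervalIntegral_add_eq (-π) 0
  rw [show -π + 2 * π = π by ring, zero_add, h0 r hr'] at this
  rw [this, smul_zero]

/-- The `n`-th Taylor coefficient at the origin. -/
def taylorCoeff (u : ℂ → ℂ) (n : ℕ) : ℂ := (n.factorial : ℂ)⁻¹ * iteratedDeriv n u 0

lemma hasSum_taylorCoeff {u : ℂ → ℂ} (hu : Differentiable ℂ u) (z : ℂ) :
    HasSum (fun n => taylorCoeff u n * z ^ n) (u z) := by
  have h := Complex.hasSum_taylorSeries_of_entire hu 0 z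
  have he : (fun n : ℕ => taylorCoeff u n * z ^ n) =
      fun n : ℕ => (n.factorial : ℂ)⁻¹ • (z - 0) ^ n • iteratedDeriv n u 0 := by
    funext n
    simp only [taylorCoeff, sub_zero, smul_eq_mul]
    ring
  rwa [he]

open scoped Real in
lemma integral_circleMap_mul_conj_pow {u : ℂ → ℂ} (hu : Differentiable ℂ u) (n : ℕ) {r : ℝ}
    (hr : 0 < r) :
    ∫ θ in (0 : ℝ)..(2 * π), u (circleMap 0 r θ) * (starRingEnd ℂ) (circleMap 0 r θ ^ n) =
      2 * π * r ^ (2 * n) * taylorCoeff u n := by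
  have h := hu.differentiableOn.circleIntegral_one_div_sub_center_pow_smul (c := 0) hr n
  rw [circleIntegral] at h
  have hpt : ∀ θ : ℝ, u (circleMap 0 r θ) * (starRingEnd ℂ) (circleMap 0 r θ ^ n) =
      (-I * r ^ (2 * n)) * (deriv (circleMap 0 r) θ •
        ((1 / (circleMap 0 r θ - 0) ^ (n + 1)) • u (circleMap 0 r θ))) := by
    intro θ
    have hne : circleMap 0 r θ ≠ 0 := circleMap_ne_center hr.ne'
    have hconj : circleMap 0 r θ * (starRingEnd ℂ) (circleMap 0 r θ) = (r : ℂ) ^ 2 := by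
      rw [Complex.mul_conj, Complex.normSq_eq_norm_sq, norm_circleMap_zero]
      simp
    rw [pow_mul, ← hconj, map_pow, deriv_circleMap, smul_eq_mul, smul_eq_mul, sub_zero]
    field_simp
    rw [Complex.I_sq]
    ring
  simp_rw [hpt]
  rw [intervalIntegral.integral_const_mul, h, taylorCoeff, smul_eq_mul]
  have : (n.factorial : ℂ) ≠ 0 := by exact_mod_cast n.factorial_ne_zero
  field_simp
  rw [Complex.I_sq]
  ring

lemma omegaW_nonneg (z : ℂ) : 0 ≤ omegaW z := by
  unfold omegaW
  positivity

lemma continuous_omegaW : Continuous omegaW := by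
  unfold omegaW
  fun_prop

lemma fockNorm_nonneg (u : ℂ → ℂ) : 0 ≤ fockNorm u := Real.sqrt_nonneg _

lemma integral_norm_pow_mul_omegaW (n : ℕ) :
    ∫ z : ℂ, ‖z ^ n‖ ^ 2 * omegaW z = n.factorial := by
  have h := Complex.integral_rpow_mul_exp_neg_rpow (p := 2) (q := (2 * n : ℕ)) (by norm_num)
    (by have : (0 : ℝ) ≤ ((2 * n : ℕ) : ℝ) := Nat.cast_nonneg _
        linarith)
  have he : ∀ z : ℂ, ‖z ^ n‖ ^ 2 * omegaW z =
      Real.pi⁻¹ * (‖z‖ ^ ((2 * n : ℕ) : ℝ) * Real.exp (-‖z‖ ^ (2 : ℝ))) := by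
    intro z
    rw [omegaW, Real.rpow_natCast, show (2 : ℝ) = ((2 : ℕ) : ℝ) by norm_num, Real.rpow_natCast,
      norm_pow]
    ring
  simp_rw [he]
  rw [integral_const_mul, h, show (((2 * n : ℕ) : ℝ) + 2) / 2 = (n : ℝ) + 1 by push_cast; ring,
    Real.Gamma_nat_eq_factorial]
  field_simp

lemma memFock_pow (n : ℕ) : MemFock fun z => z ^ n := by
  refine ⟨by fun_prop, ?_⟩
  by_contra h
  have h1 := integral_norm_pow_mul_omegaW n
  rw [integral_undef h] at h1
  exact n.factorial_ne_zero (by exact_mod_cast h1.symm)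

lemma fockNorm_pow (n : ℕ) : fockNorm (fun z => z ^ n) = √(n.factorial : ℝ) := by
  rw [fockNorm, integral_norm_pow_mul_omegaW]

lemma MemFock.integrable_norm_mul {u v : ℂ → ℂ} (hu : MemFock u) (hv : MemFock v) :
    Integrable fun z => ‖u z‖ * ‖v z‖ * omegaW z := by
  have huc := hu.1.continuous
  have hvc := hv.1.continuous
  have hoc := continuous_omegaW
  refine (hu.2.add hv.2).mono' (by fun_prop) (Eventually.of_forall fun z => ?_)
  have h0 := omegaW_nonneg z
  rw [Real.norm_of_nonneg (by positivity), Pi.add_apply, ← add_mul]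
  gcongr
  nlinarith [sq_nonneg (‖u z‖ - ‖v z‖), sq_nonneg ‖u z‖, sq_nonneg ‖v z‖]

lemma norm_fockInner_integrand (u v : ℂ → ℂ) (z : ℂ) :
    ‖u z * (starRingEnd ℂ) (v z) * (omegaW z : ℂ)‖ = ‖u z‖ * ‖v z‖ * omegaW z := by
  rw [norm_mul, norm_mul, RCLike.norm_conj, Complex.norm_real,
    Real.norm_of_nonneg (omegaW_nonneg z)]

lemma MemFock.integrable_mul_conj {u v : ℂ → ℂ} (hu : MemFock u) (hv : MemFock v) :
    Integrable fun z => u z * (starRingEnd ℂ) (v z) * (omegaW z : ℂ) := by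
  have huc := hu.1.continuous
  have hvc := hv.1.continuous
  have hoc := continuous_omegaW
  refine (hu.integrable_norm_mul hv).mono' ?_
    (Eventually.of_forall fun z => (norm_fockInner_integrand u v z).le)
  exact Continuous.aestronglyMeasurable (by fun_prop)

lemma MemFock.integral_norm_mul_le {u v : ℂ → ℂ} (hu : MemFock u) (hv : MemFock v) :
    ∫ z, ‖u z‖ * ‖v z‖ * omegaW z ≤ fockNorm u * fockNorm v := by
  have key : ∀ w : ℂ → ℂ, MemFock w → MemLp (fun z => ‖w z‖ * √(omegaW z)) (ENNReal.ofReal 2) := by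
    intro w hw
    have hwc := hw.1.continuous
    have hoc := continuous_omegaW
    rw [show ENNReal.ofReal 2 = 2 by simp]
    refine (memLp_two_iff_integrable_sq
      (Continuous.aestronglyMeasurable (by fun_prop))).2 (hw.2.congr ?_)
    refine Eventually.of_forall fun z => ?_
    simp only [mul_pow, Real.sq_sqrt (omegaW_nonneg z)]
  have h := integral_mul_le_Lp_mul_Lq_of_nonneg Real.HolderConjugate.two_two
    (Eventually.of_forall fun z => mul_nonneg (norm_nonneg (u z)) (Real.sqrt_nonneg (omegaW z)))
    (Eventually.of_forall fun z => mul_nonneg (norm_nonneg (v z)) (Real.sqrt_nonneg (omegaW z)))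
    (key u hu) (key v hv)
  have e1 : ∀ z, ‖u z‖ * √(omegaW z) * (‖v z‖ * √(omegaW z)) = ‖u z‖ * ‖v z‖ * omegaW z := by
    intro z
    rw [mul_mul_mul_comm, Real.mul_self_sqrt (omegaW_nonneg z)]
  have e2 : ∀ (w : ℂ → ℂ) (z), (‖w z‖ * √(omegaW z)) ^ (2 : ℝ) = ‖w z‖ ^ 2 * omegaW z := by
    intro w z
    rw [Real.rpow_two, mul_pow, Real.sq_sqrt (omegaW_nonneg z)]
  simp_rw [e1, e2, ← Real.sqrt_eq_rpow] at h
  exact h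

lemma MemFock.norm_fockInner_le {u v : ℂ → ℂ} (hu : MemFock u) (hv : MemFock v) :
    ‖fockInner u v‖ ≤ fockNorm u * fockNorm v := by
  refine le_trans (norm_integral_le_integral_norm _) ?_
  simp_rw [norm_fockInner_integrand]
  exact hu.integral_norm_mul_le hv

/-- Monomials reproduce Taylor coefficients in the Fock space. -/
lemma MemFock.fockInner_pow {u : ℂ → ℂ} (hu : MemFock u) (n : ℕ) :
    fockInner u (fun z => z ^ n) = n.factorial * taylorCoeff u n := by
  have hp := memFock_pow n
  have huc := hu.1.continuous
  have hoc := continuous_omegaW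
  have hi1 := hu.integrable_mul_conj hp
  have hi2 := (hp.integrable_mul_conj hp).const_mul (taylorCoeff u n)
  have hpp : ∫ z : ℂ, z ^ n * (starRingEnd ℂ) (z ^ n) * (omegaW z : ℂ) = n.factorial := by
    rw [← Complex.ofReal_natCast, ← integral_norm_pow_mul_omegaW, ← integral_complex_ofReal]
    refine integral_congr_ae (Eventually.of_forall fun z => ?_)
    simp only [Complex.mul_conj, Complex.normSq_eq_norm_sq, Complex.ofReal_mul]
  have h := integral_eq_zero_of_circle_integral_eq_zero (by fun_prop) (hi1.sub hi2) ?_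
  · simp only [Pi.sub_apply] at h
    rw [integral_sub hi1 hi2, integral_const_mul, hpp, sub_eq_zero] at h
    rw [fockInner, h, mul_comm]
  · intro r hr
    have hω : ∀ θ, omegaW (circleMap 0 r θ) = Real.pi⁻¹ * Real.exp (-r ^ 2) := by
      intro θ
      rw [omegaW, norm_circleMap_zero, sq_abs]
    have hcc := continuous_circleMap 0 r
    have hmono : ∀ θ, circleMap 0 r θ ^ n * (starRingEnd ℂ) (circleMap 0 r θ ^ n) =
        (r : ℂ) ^ (2 * n) := by
      intro θ
      rw [Complex.mul_conj, Complex.normSq_eq_norm_sq, norm_pow, norm_circleMap_zero, pow_mul,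
        ← pow_mul, mul_comm n 2, pow_mul, sq_abs]
      push_cast
      ring
    simp only [Pi.sub_apply, hω, hmono]
    rw [intervalIntegral.integral_sub
      (Continuous.intervalIntegrable (by fun_prop) _ _) (by simp),
      intervalIntegral.integral_mul_const, integral_circleMap_mul_conj_pow hu.1 n hr]
    simp
    ring

lemma MemFock.norm_taylorCoeff_le {u : ℂ → ℂ} (hu : MemFock u) (n : ℕ) :
    ‖taylorCoeff u n‖ ≤ fockNorm u / √(n.factorial : ℝ) := by
  have h := hu.norm_fockInner_le (memFock_pow n)
  have hn : (0 : ℝ) < n.factorial := by exact_mod_cast n.factorial_pos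
  rw [hu.fockInner_pow, fockNorm_pow, norm_mul, Complex.norm_natCast] at h
  have hs : (0 : ℝ) < √(n.factorial : ℝ) := Real.sqrt_pos.2 hn
  rw [le_div_iff₀ hs]
  refine le_of_mul_le_mul_right ?_ hs
  rwa [mul_assoc, Real.mul_self_sqrt hn.le, mul_comm]

lemma norm_pow_le_sqrt_factorial_mul_exp {a : ℝ} (ha : 0 < a) (k : ℕ) (z : ℂ) :
    (√a) ^ k * ‖z‖ ^ k ≤ √(k.factorial : ℝ) * Real.exp (a * ‖z‖ ^ 2) := by
  have hk : (0 : ℝ) < k.factorial := by exact_mod_cast k.factorial_pos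
  have hx : 0 ≤ a * ‖z‖ ^ 2 := by positivity
  have h1 := Real.pow_div_factorial_le_exp (a * ‖z‖ ^ 2) hx k
  rw [div_le_iff₀ hk] at h1
  have h2 : Real.exp (a * ‖z‖ ^ 2) ≤ Real.exp (a * ‖z‖ ^ 2) ^ 2 :=
    le_self_pow₀ (Real.one_le_exp hx) two_ne_zero
  refine le_of_sq_le_sq ?_ (by positivity)
  have h3 : ((√a) ^ k * ‖z‖ ^ k) ^ 2 = (a * ‖z‖ ^ 2) ^ k := by
    rw [← mul_pow, ← pow_mul, mul_comm k 2, pow_mul, mul_pow, Real.sq_sqrt ha.le]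
  rw [h3, mul_pow (√(k.factorial : ℝ)), Real.sq_sqrt hk.le]
  nlinarith

lemma norm_coeff_mul_pow_le {a U : ℝ} (ha : 0 < a) (hU : 0 ≤ U) {c : ℕ → ℂ}
    (hc : ∀ k, ‖c k‖ * √(k.factorial : ℝ) ≤ U * (√a / 2) ^ k) (k : ℕ) (z : ℂ) :
    ‖c k * z ^ k‖ ≤ U * (1 / 2) ^ k * Real.exp (a * ‖z‖ ^ 2) := by
  have hk : (0 : ℝ) < √(k.factorial : ℝ) := Real.sqrt_pos.2 (by exact_mod_cast k.factorial_pos)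
  have h1 := norm_pow_le_sqrt_factorial_mul_exp ha k z
  rw [norm_mul, norm_pow]
  refine le_of_mul_le_mul_left ?_ hk
  calc √(k.factorial : ℝ) * (‖c k‖ * ‖z‖ ^ k)
      = (‖c k‖ * √(k.factorial : ℝ)) * ‖z‖ ^ k := by ring
    _ ≤ (U * (√a / 2) ^ k) * ‖z‖ ^ k :=
        mul_le_mul_of_nonneg_right (hc k) (by positivity)
    _ = U * (1 / 2) ^ k * ((√a) ^ k * ‖z‖ ^ k) := by rw [div_pow, one_div, inv_pow]; ring
    _ ≤ U * (1 / 2) ^ k * (√(k.factorial : ℝ) * Real.exp (a * ‖z‖ ^ 2)) := by gcongr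
    _ = √(k.factorial : ℝ) * (U * (1 / 2) ^ k * Real.exp (a * ‖z‖ ^ 2)) := by ring

lemma norm_sub_partial_sum_le {a U : ℝ} (ha : 0 < a) (hU : 0 ≤ U) {c : ℕ → ℂ}
    (hc : ∀ k, ‖c k‖ * √(k.factorial : ℝ) ≤ U * (√a / 2) ^ k) {f : ℂ → ℂ}
    (hf : ∀ z, HasSum (fun k => c k * z ^ k) (f z)) (K : ℕ) (z : ℂ) :
    ‖f z - ∑ k ∈ Finset.range K, c k * z ^ k‖ ≤
      2 * U * (1 / 2) ^ K * Real.exp (a * ‖z‖ ^ 2) := by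
  have h1 := (hasSum_nat_add_iff' K).2 (hf z)
  have h2 := hasSum_geometric_two.mul_left (U * (1 / 2) ^ K * Real.exp (a * ‖z‖ ^ 2))
  have h3 := tsum_of_norm_bounded h2 fun k => by
    refine (norm_coeff_mul_pow_le ha hU hc (k + K) z).trans (le_of_eq ?_)
    rw [pow_add]
    ring
  rw [h1.tsum_eq] at h3
  linarith

/-- A sequence of growth `O(√k! 4⁻ᵏ)`, paired with Taylor coefficients, is represented by an element
of `𝓑`. -/
lemma exists_memFock_hasSum_fockInner {ℓ : ℕ → ℂ} {U : ℝ}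
    (hℓ : ∀ k, ‖ℓ k‖ ≤ U * √(k.factorial : ℝ) * (1 / 4) ^ k) :
    ∃ g, MemFock g ∧
      ∀ u, MemFock u → HasSum (fun k => taylorCoeff u k * ℓ k) (fockInner u g) := by
  have hU : 0 ≤ U := by
    have := (norm_nonneg _).trans (hℓ 0)
    simpa using this
  have hfac : ∀ k : ℕ, (0 : ℝ) < k.factorial := fun k => by exact_mod_cast k.factorial_pos
  set c : ℕ → ℂ := fun k => (starRingEnd ℂ) (ℓ k) / k.factorial with hc
  have hnc : ∀ k, ‖c k‖ * √(k.factorial : ℝ) ≤ U * (1 / 4) ^ k := by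
    intro k
    simp only [hc, norm_div, RCLike.norm_conj, Complex.norm_natCast]
    rw [div_mul_eq_mul_div, div_le_iff₀ (hfac k)]
    calc ‖ℓ k‖ * √(k.factorial : ℝ)
        ≤ (U * √(k.factorial : ℝ) * (1 / 4) ^ k) * √(k.factorial : ℝ) := by gcongr; exact hℓ k
      _ = U * (1 / 4) ^ k * (√(k.factorial : ℝ) * √(k.factorial : ℝ)) := by ring
      _ = _ := by rw [Real.mul_self_sqrt (hfac k).le]
  have hs : √(1 / 4 : ℝ) / 2 = 1 / 4 := by
    rw [show (1 / 4 : ℝ) = (1 / 2) ^ 2 by norm_num, Real.sqrt_sq (by norm_num)]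
    norm_num
  have hnc' : ∀ k, ‖c k‖ * √(k.factorial : ℝ) ≤ U * (√(1 / 4 : ℝ) / 2) ^ k := by
    intro k
    rw [hs]
    exact hnc k
  have hterm := norm_coeff_mul_pow_le (by norm_num : (0 : ℝ) < 1 / 4) hU hnc'
  have hsum : ∀ z, HasSum (fun k => c k * z ^ k) (∑' k, c k * z ^ k) := fun z =>
    (Summable.of_norm_bounded ((summable_geometric_two.mul_left U).mul_right _)
      (fun k => hterm k z)).hasSum
  have hbound : ∀ z, ‖∑' k, c k * z ^ k‖ ≤ 2 * U * Real.exp (1 / 4 * ‖z‖ ^ 2) := by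
    intro z
    simpa using norm_sub_partial_sum_le (by norm_num : (0 : ℝ) < 1 / 4) hU hnc' hsum 0 z
  have hdiff : Differentiable ℂ fun z => ∑' k, c k * z ^ k := by
    intro z
    refine DifferentiableOn.differentiableAt (s := ball 0 (‖z‖ + 1)) ?_
      (isOpen_ball.mem_nhds (by simp))
    refine Complex.differentiableOn_tsum_of_summable_norm
      ((summable_geometric_two.mul_left U).mul_right (Real.exp (1 / 4 * (‖z‖ + 1) ^ 2)))
      (fun k => by fun_prop) isOpen_ball fun k w hw => (hterm k w).trans ?_
    have hw' : ‖w‖ ≤ ‖z‖ + 1 := by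
      rw [mem_ball_zero_iff] at hw
      exact hw.le
    gcongr
  have hfock : MemFock fun z => ∑' k, c k * z ^ k := by
    have hoc := continuous_omegaW
    have hgc := hdiff.continuous
    refine ⟨hdiff, ?_⟩
    have hgauss : Integrable fun z : ℂ => Real.exp (-(1 / 2) * ‖z‖ ^ (2 : ℝ)) := by
      by_contra h
      have h1 := Complex.integral_exp_neg_mul_rpow (p := 2) (b := 1 / 2) (by norm_num) (by norm_num)
      rw [integral_undef h] at h1
      have h2 : 0 < Real.Gamma (2 / 2 + 1) := Real.Gamma_pos_of_pos (by norm_num)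
      have h3 : (0 : ℝ) < Real.pi * (1 / 2) ^ (-(2 : ℝ) / 2) * Real.Gamma (2 / 2 + 1) := by
        positivity
      exact h3.ne h1
    refine (hgauss.const_mul ((2 * U) ^ 2 * Real.pi⁻¹)).mono' (by fun_prop)
      (Eventually.of_forall fun z => ?_)
    have h0 := omegaW_nonneg z
    rw [Real.norm_of_nonneg (by positivity), Real.rpow_two]
    calc ‖∑' k, c k * z ^ k‖ ^ 2 * omegaW z
        ≤ (2 * U * Real.exp (1 / 4 * ‖z‖ ^ 2)) ^ 2 * omegaW z := by
          gcongr
          exact hbound z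
      _ = _ := by
          rw [omegaW, mul_pow, ← Real.exp_nat_mul,
            show -(1 / 2) * ‖z‖ ^ 2 = (2 : ℕ) * (1 / 4 * ‖z‖ ^ 2) + -‖z‖ ^ 2 by push_cast; ring,
            Real.exp_add]
          ring
  refine ⟨_, hfock, fun u hu => ?_⟩
  have hint : ∀ k, Integrable fun z =>
      (starRingEnd ℂ) (c k) * (u z * (starRingEnd ℂ) (z ^ k) * (omegaW z : ℂ)) := fun k =>
    (hu.integrable_mul_conj (memFock_pow k)).const_mul _
  have hnorm : ∀ k, ∫ z, ‖(starRingEnd ℂ) (c k) *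
      (u z * (starRingEnd ℂ) (z ^ k) * (omegaW z : ℂ))‖ ≤ fockNorm u * U * (1 / 4) ^ k := by
    intro k
    have h1 := hu.integral_norm_mul_le (memFock_pow k)
    rw [fockNorm_pow] at h1
    have he : ∀ z, ‖(starRingEnd ℂ) (c k) * (u z * (starRingEnd ℂ) (z ^ k) * (omegaW z : ℂ))‖ =
        ‖c k‖ * (‖u z‖ * ‖z ^ k‖ * omegaW z) := fun z => by
      rw [norm_mul, norm_fockInner_integrand u (fun z => z ^ k), RCLike.norm_conj]
    simp_rw [he]
    rw [integral_const_mul]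
    calc ‖c k‖ * ∫ z, ‖u z‖ * ‖z ^ k‖ * omegaW z
        ≤ ‖c k‖ * (fockNorm u * √(k.factorial : ℝ)) := by gcongr
      _ = fockNorm u * (‖c k‖ * √(k.factorial : ℝ)) := by ring
      _ ≤ fockNorm u * (U * (1 / 4) ^ k) :=
          mul_le_mul_of_nonneg_left (hnc k) (fockNorm_nonneg u)
      _ = _ := by ring
  have hsummable : Summable fun k => ∫ z, ‖(starRingEnd ℂ) (c k) *
      (u z * (starRingEnd ℂ) (z ^ k) * (omegaW z : ℂ))‖ :=
    Summable.of_nonneg_of_le (fun k => integral_nonneg fun z => norm_nonneg _) hnorm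
      ((summable_geometric_of_lt_one (by norm_num) (by norm_num)).mul_left _)
  have h := hasSum_integral_of_summable_integral_norm hint hsummable
  have hl : (fun k => taylorCoeff u k * ℓ k) = fun k => ∫ z, (starRingEnd ℂ) (c k) *
      (u z * (starRingEnd ℂ) (z ^ k) * (omegaW z : ℂ)) := by
    funext k
    have hk : (k.factorial : ℂ) ≠ 0 := by exact_mod_cast k.factorial_ne_zero
    have := hu.fockInner_pow k
    rw [fockInner] at this
    rw [integral_const_mul, this]
    simp only [hc, map_div₀, Complex.conj_conj, map_natCast]
    field_simp
  have hr : fockInner u (fun z => ∑' k, c k * z ^ k) = ∫ z, ∑' k, (starRingEnd ℂ) (c k) *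
      (u z * (starRingEnd ℂ) (z ^ k) * (omegaW z : ℂ)) := by
    refine integral_congr_ae (Eventually.of_forall fun z => ?_)
    have h1 := (((Complex.hasSum_conj'.2 (hsum z)).mul_left (u z)).mul_right
      (omegaW z : ℂ)).tsum_eq
    simp only
    rw [← h1]
    refine tsum_congr fun k => ?_
    simp only [map_mul]
    ring
  rw [hl, hr]
  exact h

/-- Entire functions bounded by `M * exp (a|z|²)`. -/
structure ExpBound (a M : ℝ) (f : ℂ → ℂ) : Prop where
  differentiable : Differentiable ℂ f
  nonneg : 0 ≤ M
  bound : ∀ z, ‖f z‖ ≤ M * Real.exp (a * ‖z‖ ^ 2)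

namespace ExpBound

lemma sub {a M M' : ℝ} {f g : ℂ → ℂ} (hf : ExpBound a M f) (hg : ExpBound a M' g) :
    ExpBound a (M + M') (fun z => f z - g z) where
  differentiable := hf.differentiable.sub hg.differentiable
  nonneg := add_nonneg hf.nonneg hg.nonneg
  bound z := by
    rw [add_mul]
    exact (norm_sub_le _ _).trans (add_le_add (hf.bound z) (hg.bound z))

lemma add {a M M' : ℝ} {f g : ℂ → ℂ} (hf : ExpBound a M f) (hg : ExpBound a M' g) :
    ExpBound a (M + M') (fun z => f z + g z) where
  differentiable := hf.differentiable.add hg.differentiable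
  nonneg := add_nonneg hf.nonneg hg.nonneg
  bound z := by
    rw [add_mul]
    exact (norm_add_le _ _).trans (add_le_add (hf.bound z) (hg.bound z))

lemma const_mul {a M : ℝ} {f : ℂ → ℂ} (hf : ExpBound a M f) (c : ℂ) :
    ExpBound a (‖c‖ * M) (fun z => c * f z) where
  differentiable := hf.differentiable.const_mul c
  nonneg := mul_nonneg (norm_nonneg c) hf.nonneg
  bound z := by
    rw [norm_mul, mul_assoc]
    exact mul_le_mul_of_nonneg_left (hf.bound z) (norm_nonneg c)

lemma zero (a : ℝ) : ExpBound a 0 (fun _ => 0) where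
  differentiable := differentiable_const 0
  nonneg := le_rfl
  bound z := by simp

lemma pow {a : ℝ} (ha : 0 < a) (k : ℕ) :
    ExpBound a (√(k.factorial : ℝ) * (√a)⁻¹ ^ k) (fun z => z ^ k) where
  differentiable := by fun_prop
  nonneg := by positivity
  bound z := by
    have hs : 0 < √a := Real.sqrt_pos.2 ha
    have h := norm_pow_le_sqrt_factorial_mul_exp ha k z
    rw [norm_pow, inv_pow, mul_right_comm, ← div_eq_mul_inv, le_div_iff₀ (by positivity), mul_comm]
    exact h

lemma exists_sum_range {a : ℝ} (ha : 0 < a) (c : ℕ → ℂ) (K : ℕ) :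
    ∃ M, ExpBound a M fun z => ∑ k ∈ Finset.range K, c k * z ^ k := by
  induction K with
  | zero => exact ⟨0, by simpa using zero a⟩
  | succ K ih =>
    obtain ⟨M, hM⟩ := ih
    simp_rw [Finset.sum_range_succ]
    exact ⟨_, hM.add ((pow ha K).const_mul (c K))⟩

lemma norm_iteratedFDeriv_le {a M : ℝ} (ha : 0 ≤ a) {f : ℂ → ℂ} (hf : ExpBound a M f) (n : ℕ)
    (z : ℂ) :
    ‖iteratedFDeriv ℝ n f z‖ ≤
      n.factorial * (M * Real.exp (2 * a)) * Real.exp (2 * a * ‖z‖ ^ 2) := by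
  have h1 : ‖iteratedFDeriv ℝ n f z‖ = ‖iteratedDeriv n f z‖ := by
    rw [← hf.differentiable.contDiff.contDiffAt.restrictScalars_iteratedFDeriv,
      ← norm_iteratedFDeriv_eq_norm_iteratedDeriv, Function.comp_apply,
      ContinuousMultilinearMap.norm_restrictScalars]
  rw [h1]
  have h2 := Complex.norm_iteratedDeriv_le_of_forall_mem_sphere_norm_le (c := z) (R := 1)
    (C := M * Real.exp (2 * a) * Real.exp (2 * a * ‖z‖ ^ 2)) n one_pos
    hf.differentiable.diffContOnCl ?_
  · simpa [mul_assoc] using h2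
  · intro w hw
    have hw1 : ‖w - z‖ = 1 := by simpa [dist_eq_norm] using hw
    have hw2 : ‖w‖ ≤ ‖z‖ + 1 := by
      have := norm_add_le (w - z) z
      rw [sub_add_cancel] at this
      linarith
    have hw3 : ‖w‖ ^ 2 ≤ 2 + 2 * ‖z‖ ^ 2 := by
      nlinarith [norm_nonneg w, norm_nonneg z, sq_nonneg (‖z‖ - 1)]
    refine (hf.bound w).trans ?_
    rw [mul_assoc, ← Real.exp_add]
    refine mul_le_mul_of_nonneg_left (Real.exp_le_exp.2 ?_) hf.nonneg
    nlinarith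

lemma norm_iteratedFDeriv_mul_conj_le {a M M' : ℝ} (ha : 0 ≤ a) {f g : ℂ → ℂ}
    (hf : ExpBound a M f) (hg : ExpBound a M' g) {n l : ℕ} (hn : n ≤ l) (z : ℂ) :
    ‖iteratedFDeriv ℝ n (fun z => f z * (starRingEnd ℂ) (g z)) z‖ ≤
      (2 ^ l * (l.factorial : ℝ) ^ 2 * Real.exp (4 * a)) * M * M' *
        Real.exp (4 * a * ‖z‖ ^ 2) := by
  have hfc : ContDiff ℝ n f := hf.differentiable.contDiff.restrict_scalars ℝ
  have hgc : ContDiff ℝ n g := hg.differentiable.contDiff.restrict_scalars ℝ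
  have hgc' : ContDiff ℝ n fun z => (starRingEnd ℂ) (g z) :=
    Complex.conjCLE.contDiff.comp hgc
  have hM := hf.nonneg
  have hM' := hg.nonneg
  refine (norm_iteratedFDeriv_mul_le hfc hgc' z le_rfl).trans ?_
  set X := M * Real.exp (2 * a) * Real.exp (2 * a * ‖z‖ ^ 2) with hX
  set Y := M' * Real.exp (2 * a) * Real.exp (2 * a * ‖z‖ ^ 2) with hY
  have hX0 : 0 ≤ X := by positivity
  have hY0 : 0 ≤ Y := by positivity
  have hterm : ∀ i ∈ Finset.range (n + 1),
      (n.choose i : ℝ) * ‖iteratedFDeriv ℝ i f z‖ *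
        ‖iteratedFDeriv ℝ (n - i) (fun z => (starRingEnd ℂ) (g z)) z‖ ≤
      (n.choose i : ℝ) * (l.factorial * X) * (l.factorial * Y) := by
    intro i hi
    have hi' : i ≤ l := by
      have := Finset.mem_range.1 hi
      omega
    have e1 : ‖iteratedFDeriv ℝ i f z‖ ≤ l.factorial * X := by
      refine (hf.norm_iteratedFDeriv_le ha i z).trans ?_
      rw [mul_assoc]
      exact mul_le_mul_of_nonneg_right (by exact_mod_cast Nat.factorial_le hi') hX0
    have e2 : ‖iteratedFDeriv ℝ (n - i) (fun z => (starRingEnd ℂ) (g z)) z‖ ≤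
        l.factorial * Y := by
      have := Complex.conjLIE.norm_iteratedFDeriv_comp_left g z (n - i)
      have e : (Complex.conjLIE ∘ g) = fun z => (starRingEnd ℂ) (g z) := rfl
      rw [e] at this
      rw [this]
      refine (hg.norm_iteratedFDeriv_le ha _ z).trans ?_
      rw [mul_assoc]
      exact mul_le_mul_of_nonneg_right
        (by exact_mod_cast Nat.factorial_le ((Nat.sub_le n i).trans hn)) hY0
    gcongr
  refine (Finset.sum_le_sum hterm).trans ?_
  rw [← Finset.sum_mul, ← Finset.sum_mul, ← Nat.cast_sum, Nat.sum_range_choose]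
  have h2 : ((2 ^ n : ℕ) : ℝ) ≤ 2 ^ l := by
    push_cast
    exact pow_le_pow_right₀ one_le_two hn
  calc ((2 ^ n : ℕ) : ℝ) * (l.factorial * X) * (l.factorial * Y)
      ≤ 2 ^ l * (l.factorial * X) * (l.factorial * Y) := by gcongr
    _ = _ := by
        rw [hX, hY, show 4 * a * ‖z‖ ^ 2 = 2 * a * ‖z‖ ^ 2 + 2 * a * ‖z‖ ^ 2 by ring,
          show 4 * a = 2 * a + 2 * a by ring, Real.exp_add, Real.exp_add]
        ring

lemma norm_iteratedFDeriv_mul_conj_mul_exp_le {a M M' : ℝ} (ha : 0 ≤ a) {f g : ℂ → ℂ}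
    (hf : ExpBound a M f) (hg : ExpBound a M' g) {n l : ℕ} (hn : n ≤ l) (z : ℂ) :
    ‖iteratedFDeriv ℝ n (fun z => f z * (starRingEnd ℂ) (g z)) z‖ *
        Real.exp (-(8 * a) * ‖z‖ ^ 2) ≤
      (2 ^ l * (l.factorial : ℝ) ^ 2 * Real.exp (4 * a)) * M * M' *
        Real.exp (-(4 * a) * ‖z‖ ^ 2) := by
  refine (mul_le_mul_of_nonneg_right (hf.norm_iteratedFDeriv_mul_conj_le ha hg hn z)
    (Real.exp_nonneg _)).trans (le_of_eq ?_)
  rw [mul_assoc, ← Real.exp_add]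
  ring_nf

lemma memLambda {a M M' : ℝ} (ha : 0 < a) {f g : ℂ → ℂ}
    (hf : ExpBound a M f) (hg : ExpBound a M' g) (l : ℕ) :
    MemLambda (8 * a) l fun z => f z * (starRingEnd ℂ) (g z) := by
  refine ⟨?_, fun n hn => ?_⟩
  · have hfc : ContDiff ℝ (l : ℕ∞) f := hf.differentiable.contDiff.restrict_scalars ℝ
    have hgc : ContDiff ℝ (l : ℕ∞) g := hg.differentiable.contDiff.restrict_scalars ℝ
    exact hfc.mul (Complex.conjCLE.contDiff.comp hgc)
  · refine squeeze_zero (fun z => by positivity)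
      (fun z => hf.norm_iteratedFDeriv_mul_conj_mul_exp_le ha.le hg hn z) ?_
    have hsq : Tendsto (fun z : ℂ => ‖z‖ ^ 2) (cocompact ℂ) atTop :=
      (tendsto_pow_atTop two_ne_zero).comp (tendsto_norm_cocompact_atTop (E := ℂ))
    have hexp := Real.tendsto_exp_atBot.comp
      (hsq.const_mul_atTop_of_neg (by linarith : -(4 * a) < 0))
    simpa using hexp.const_mul ((2 ^ l * (l.factorial : ℝ) ^ 2 * Real.exp (4 * a)) * M * M')

lemma lambdaNorm_mul_conj_le {a M M' : ℝ} (ha : 0 < a) {f g : ℂ → ℂ}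
    (hf : ExpBound a M f) (hg : ExpBound a M' g) (l : ℕ) :
    lambdaNorm (8 * a) l (fun z => f z * (starRingEnd ℂ) (g z)) ≤
      (2 ^ l * (l.factorial : ℝ) ^ 2 * Real.exp (4 * a)) * M * M' := by
  have hM := hf.nonneg
  have hM' := hg.nonneg
  refine Real.sSup_le ?_ (by positivity)
  rintro r ⟨n, hn, z, rfl⟩
  refine (hf.norm_iteratedFDeriv_mul_conj_mul_exp_le ha.le hg hn z).trans ?_
  refine mul_le_of_le_one_right (by positivity) (Real.exp_le_one_iff.2 ?_)
  have : 0 ≤ 4 * a * ‖z‖ ^ 2 := by positivity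
  linarith

end ExpBound

section ToeplitzForm

variable {a : ℝ} {l : ℕ} {T : Dst}

lemma MemLambdaDual.exists_norm_toeplitzForm_le (ha : 0 < a) (hT : MemLambdaDual (8 * a) l T) :
    ∃ B, 0 ≤ B ∧ ∀ {M M' : ℝ} {f g : ℂ → ℂ}, ExpBound a M f → ExpBound a M' g →
      ‖toeplitzForm T f g‖ ≤ B * M * M' := by
  obtain ⟨C, hC⟩ := hT.2.2
  refine ⟨|C| * (2 ^ l * (l.factorial : ℝ) ^ 2 * Real.exp (4 * a)), by positivity,
    fun {M M' f g} hf hg => ?_⟩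
  have h0 : 0 ≤ lambdaNorm (8 * a) l (fun z => f z * (starRingEnd ℂ) (g z)) := by
    refine Real.sSup_nonneg ?_
    rintro r ⟨n, hn, z, rfl⟩
    positivity
  calc ‖toeplitzForm T f g‖
      ≤ C * lambdaNorm (8 * a) l (fun z => f z * (starRingEnd ℂ) (g z)) :=
        hC _ (hf.memLambda ha hg l)
    _ ≤ |C| * lambdaNorm (8 * a) l (fun z => f z * (starRingEnd ℂ) (g z)) :=
        mul_le_mul_of_nonneg_right (le_abs_self C) h0
    _ ≤ |C| * ((2 ^ l * (l.factorial : ℝ) ^ 2 * Real.exp (4 * a)) * M * M') :=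
        mul_le_mul_of_nonneg_left (hf.lambdaNorm_mul_conj_le ha hg l) (abs_nonneg C)
    _ = _ := by ring

lemma MemLambdaDual.toeplitzForm_add_left (ha : 0 < a) (hT : MemLambdaDual (8 * a) l T)
    {M₁ M₂ M' : ℝ} {f₁ f₂ g : ℂ → ℂ} (h₁ : ExpBound a M₁ f₁) (h₂ : ExpBound a M₂ f₂)
    (hg : ExpBound a M' g) :
    toeplitzForm T (fun z => f₁ z + f₂ z) g = toeplitzForm T f₁ g + toeplitzForm T f₂ g := by
  rw [toeplitzForm, toeplitzForm, toeplitzForm,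
    ← hT.1 _ _ (h₁.memLambda ha hg l) (h₂.memLambda ha hg l)]
  congr 1
  funext z
  simp only [Pi.add_apply]
  ring

lemma MemLambdaDual.toeplitzForm_add_right (ha : 0 < a) (hT : MemLambdaDual (8 * a) l T)
    {M₁ M₂ M' : ℝ} {g₁ g₂ f : ℂ → ℂ} (hf : ExpBound a M' f) (h₁ : ExpBound a M₁ g₁)
    (h₂ : ExpBound a M₂ g₂) :
    toeplitzForm T f (fun z => g₁ z + g₂ z) = toeplitzForm T f g₁ + toeplitzForm T f g₂ := by
  rw [toeplitzForm, toeplitzForm, toeplitzForm,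
    ← hT.1 _ _ (hf.memLambda ha h₁ l) (hf.memLambda ha h₂ l)]
  congr 1
  funext z
  simp only [Pi.add_apply, map_add]
  ring

lemma MemLambdaDual.toeplitzForm_const_mul_left (ha : 0 < a) (hT : MemLambdaDual (8 * a) l T)
    {M M' : ℝ} {f g : ℂ → ℂ} (hf : ExpBound a M f) (hg : ExpBound a M' g) (c : ℂ) :
    toeplitzForm T (fun z => c * f z) g = c * toeplitzForm T f g := by
  rw [toeplitzForm, toeplitzForm, ← hT.2.1 _ _ (hf.memLambda ha hg l)]
  congr 1
  funext z
  simp only [Pi.smul_apply, smul_eq_mul]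
  ring

lemma MemLambdaDual.toeplitzForm_const_mul_right (ha : 0 < a) (hT : MemLambdaDual (8 * a) l T)
    {M M' : ℝ} {f g : ℂ → ℂ} (hf : ExpBound a M f) (hg : ExpBound a M' g) (c : ℂ) :
    toeplitzForm T f (fun z => c * g z) = (starRingEnd ℂ) c * toeplitzForm T f g := by
  rw [toeplitzForm, toeplitzForm, ← hT.2.1 _ _ (hf.memLambda ha hg l)]
  congr 1
  funext z
  simp only [Pi.smul_apply, smul_eq_mul, map_mul]
  ring

lemma MemLambdaDual.toeplitzForm_sum_left (ha : 0 < a) (hT : MemLambdaDual (8 * a) l T)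
    {M : ℝ} {g : ℂ → ℂ} (hg : ExpBound a M g) (c : ℕ → ℂ) (K : ℕ) :
    toeplitzForm T (fun z => ∑ k ∈ Finset.range K, c k * z ^ k) g =
      ∑ k ∈ Finset.range K, c k * toeplitzForm T (fun z => z ^ k) g := by
  induction K with
  | zero =>
    have := hT.toeplitzForm_const_mul_left ha (ExpBound.zero a) hg 0
    simpa using this
  | succ K ih =>
    obtain ⟨M', hM'⟩ := ExpBound.exists_sum_range ha c K
    simp_rw [Finset.sum_range_succ]
    rw [hT.toeplitzForm_add_left ha hM' ((ExpBound.pow ha K).const_mul (c K)) hg, ih,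
      hT.toeplitzForm_const_mul_left ha (ExpBound.pow ha K) hg]

lemma MemLambdaDual.toeplitzForm_sum_right (ha : 0 < a) (hT : MemLambdaDual (8 * a) l T)
    {M : ℝ} {f : ℂ → ℂ} (hf : ExpBound a M f) (d : ℕ → ℂ) (K : ℕ) :
    toeplitzForm T f (fun z => ∑ k ∈ Finset.range K, d k * z ^ k) =
      ∑ k ∈ Finset.range K, (starRingEnd ℂ) (d k) * toeplitzForm T f (fun z => z ^ k) := by
  induction K with
  | zero =>
    have := hT.toeplitzForm_const_mul_right ha hf (ExpBound.zero a) 0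
    simpa using this
  | succ K ih =>
    obtain ⟨M', hM'⟩ := ExpBound.exists_sum_range ha d K
    simp_rw [Finset.sum_range_succ]
    rw [hT.toeplitzForm_add_right ha hf hM' ((ExpBound.pow ha K).const_mul (d K)), ih,
      hT.toeplitzForm_const_mul_right ha hf (ExpBound.pow ha K)]

lemma MemLambdaDual.tendsto_sum_matP (ha : 0 < a) (hT : MemLambdaDual (8 * a) l T)
    {f g : ℂ → ℂ} (hf : Differentiable ℂ f) (hg : Differentiable ℂ g) {c d : ℕ → ℂ} {U V : ℝ}
    (hU : 0 ≤ U) (hV : 0 ≤ V)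
    (hc : ∀ k, ‖c k‖ * √(k.factorial : ℝ) ≤ U * (√a / 2) ^ k)
    (hd : ∀ k, ‖d k‖ * √(k.factorial : ℝ) ≤ V * (√a / 2) ^ k)
    (hcf : ∀ z, HasSum (fun k => c k * z ^ k) (f z))
    (hdg : ∀ z, HasSum (fun k => d k * z ^ k) (g z)) :
    Tendsto (fun K => ∑ k ∈ Finset.range K, ∑ k' ∈ Finset.range K,
      c k * ((starRingEnd ℂ) (d k') * matP T k k')) atTop (nhds (toeplitzForm T f g)) := by
  obtain ⟨B, hB, hTB⟩ := hT.exists_norm_toeplitzForm_le ha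
  set F : ℕ → ℂ → ℂ := fun K z => ∑ k ∈ Finset.range K, c k * z ^ k with hF
  set G : ℕ → ℂ → ℂ := fun K z => ∑ k ∈ Finset.range K, d k * z ^ k with hG
  have hFd : ∀ K, Differentiable ℂ (F K) := fun K => by
    obtain ⟨M, hM⟩ := ExpBound.exists_sum_range ha c K
    exact hM.differentiable
  have hGd : ∀ K, Differentiable ℂ (G K) := fun K => by
    obtain ⟨M, hM⟩ := ExpBound.exists_sum_range ha d K
    exact hM.differentiable
  have hFt : ∀ K, ExpBound a (2 * U * (1 / 2) ^ K) (fun z => f z - F K z) := fun K =>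
    ⟨hf.sub (hFd K), by positivity, norm_sub_partial_sum_le ha hU hc hcf K⟩
  have hGt : ∀ K, ExpBound a (2 * V * (1 / 2) ^ K) (fun z => g z - G K z) := fun K =>
    ⟨hg.sub (hGd K), by positivity, norm_sub_partial_sum_le ha hV hd hdg K⟩
  have hfb : ExpBound a (2 * U) f := by simpa [hF] using hFt 0
  have hgb : ExpBound a (2 * V) g := by simpa [hG] using hGt 0
  have hGb : ∀ K, ExpBound a (2 * V + 2 * V * (1 / 2) ^ K) (G K) := fun K => by
    simpa using hgb.sub (hGt K)
  have hFb : ∀ K, ExpBound a (2 * U + 2 * U * (1 / 2) ^ K) (F K) := fun K => by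
    simpa using hfb.sub (hFt K)
  have hsum : ∀ K, ∑ k ∈ Finset.range K, ∑ k' ∈ Finset.range K,
      c k * ((starRingEnd ℂ) (d k') * matP T k k') = toeplitzForm T (F K) (G K) := fun K => by
    rw [hF, hT.toeplitzForm_sum_left ha (hGb K)]
    refine Finset.sum_congr rfl fun k _ => ?_
    rw [hG, hT.toeplitzForm_sum_right ha (ExpBound.pow ha k), Finset.mul_sum]
    rfl
  simp_rw [hsum]
  have hdecomp : ∀ K, toeplitzForm T (F K) (G K) - toeplitzForm T f g =
      -(toeplitzForm T (fun z => f z - F K z) g +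
        toeplitzForm T (F K) (fun z => g z - G K z)) := fun K => by
    have h1 := hT.toeplitzForm_add_left ha (hFb K) (hFt K) hgb
    have h2 := hT.toeplitzForm_add_right ha (hFb K) (hGb K) (hGt K)
    simp only [add_sub_cancel] at h1 h2
    rw [h1, h2]
    ring
  rw [tendsto_iff_norm_sub_tendsto_zero]
  refine squeeze_zero (fun K => norm_nonneg _)
    (g := fun K => B * (2 * U * (1 / 2) ^ K) * (2 * V) +
      B * (2 * U + 2 * U * (1 / 2) ^ K) * (2 * V * (1 / 2) ^ K)) (fun K => ?_) ?_
  · rw [hdecomp, norm_neg]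
    exact (norm_add_le _ _).trans (add_le_add (hTB (hFt K) hgb) (hTB (hFb K) (hGt K)))
  · have h0 : Tendsto (fun K : ℕ => (1 / 2 : ℝ) ^ K) atTop (nhds 0) :=
      tendsto_pow_atTop_nhds_zero_of_lt_one (by norm_num) (by norm_num)
    have h1 := h0.const_mul (2 * U)
    have h2 := h0.const_mul (2 * V)
    have := ((h1.const_mul B).mul_const (2 * V)).add
      (((h1.const_add (2 * U)).const_mul B).mul h2)
    simpa using this

end ToeplitzForm

lemma fockInner_conj_symm (u v : ℂ → ℂ) :
    (starRingEnd ℂ) (fockInner u v) = fockInner v u := by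
  rw [fockInner, fockInner, ← integral_conj]
  refine integral_congr_ae (Eventually.of_forall fun z => ?_)
  simp only [map_mul, Complex.conj_conj, Complex.conj_ofReal]
  ring

lemma memFock_zero : MemFock 0 := by
  refine ⟨differentiable_const 0, ?_⟩
  simp

lemma fockInner_zero_left (v : ℂ → ℂ) : fockInner 0 v = 0 := by
  simp [fockInner]

lemma scaleW_mul_conj {q : ℝ} {l : ℕ} {T : Dst} (hT : MemLambdaDual q l T) {t : ℝ} {u v : ℂ → ℂ}
    (h : MemLambda q l fun z => u ((t⁻¹ : ℝ) * z) * (starRingEnd ℂ) (v ((t⁻¹ : ℝ) * z))) :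
    scaleW t T (fun z => u z * (starRingEnd ℂ) (v z)) =
      (t⁻¹ : ℝ) * toeplitzForm T (fun z => u ((t⁻¹ : ℝ) * z)) (fun z => v ((t⁻¹ : ℝ) * z)) :=
  hT.2.1 (t⁻¹ : ℝ) _ h

lemma MemFock.hasSum_scaled {u : ℂ → ℂ} (hu : MemFock u) (s : ℝ) (z : ℂ) :
    HasSum (fun k => (taylorCoeff u k * (s : ℂ) ^ k) * z ^ k) (u (s * z)) := by
  have h := hasSum_taylorCoeff hu.1 (s * z)
  simpa only [mul_pow, mul_assoc] using h

lemma MemFock.norm_scaled_coeff_le {u : ℂ → ℂ} (hu : MemFock u) {a s : ℝ} (hs : 0 ≤ s)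
    (hsa : s ≤ √a / 4) (k : ℕ) :
    ‖taylorCoeff u k * (s : ℂ) ^ k‖ * √(k.factorial : ℝ) ≤ fockNorm u * (√a / 2) ^ k := by
  have hk : (0 : ℝ) < √(k.factorial : ℝ) := Real.sqrt_pos.2 (by exact_mod_cast k.factorial_pos)
  have h1 := hu.norm_taylorCoeff_le k
  rw [le_div_iff₀ hk] at h1
  rw [norm_mul, norm_pow, Complex.norm_real, Real.norm_of_nonneg hs, mul_right_comm]
  have h2 : s ≤ √a / 2 := by linarith [Real.sqrt_nonneg a]
  have h0 := fockNorm_nonneg u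
  exact mul_le_mul h1 (pow_le_pow_left₀ hs h2 k) (by positivity) h0

lemma MemFock.expBound_scaled {u : ℂ → ℂ} (hu : MemFock u) {a s : ℝ} (ha : 0 < a) (hs : 0 ≤ s)
    (hsa : s ≤ √a / 4) : ExpBound a (2 * fockNorm u) fun z => u (s * z) := by
  have h0 := fockNorm_nonneg u
  refine ⟨hu.1.comp (differentiable_id.const_mul _), by positivity, fun z => ?_⟩
  simpa using norm_sub_partial_sum_le ha h0 (hu.norm_scaled_coeff_le hs hsa)
    (hu.hasSum_scaled s) 0 z

lemma norm_pow_mul_le_of_scale {a s U : ℝ} (ha : 0 < a) (hs : 0 ≤ s) (hsa : s ≤ √a / 4) {x : ℂ}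
    {k : ℕ} (hx : ‖x‖ ≤ U * (√(k.factorial : ℝ) * (√a)⁻¹ ^ k)) :
    ‖(s : ℂ) ^ k * x‖ ≤ U * √(k.factorial : ℝ) * (1 / 4) ^ k := by
  have ha' : 0 < √a := Real.sqrt_pos.2 ha
  have hk : (0 : ℝ) < √(k.factorial : ℝ) := Real.sqrt_pos.2 (by exact_mod_cast k.factorial_pos)
  have hU : 0 ≤ U := by
    have h1 := (norm_nonneg x).trans hx
    exact nonneg_of_mul_nonneg_left h1 (by positivity)
  have h2 : s * (√a)⁻¹ ≤ 1 / 4 := by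
    rw [← div_eq_mul_inv, div_le_iff₀ ha']
    linarith
  rw [norm_mul, norm_pow, Complex.norm_real, Real.norm_of_nonneg hs]
  calc s ^ k * ‖x‖ ≤ s ^ k * (U * (√(k.factorial : ℝ) * (√a)⁻¹ ^ k)) := by gcongr
    _ = U * √(k.factorial : ℝ) * (s * (√a)⁻¹) ^ k := by rw [mul_pow]; ring
    _ ≤ _ := by gcongr

/-- **Finite rank of the matrices implies finite rank of the scaled Toeplitz
operator.** If `𝐅 = ωF ∈ Λ'_{q,l}` and the matrices `𝔓(F)` and `𝔎(F)` have rank at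
most `N`, then for all sufficiently large `t` the Toeplitz operator of the scaled
symbol `F_t` (whose form is `⟨W_t𝐅, u v̄⟩`) is bounded on `𝓑` and has rank at most
`N`. -/
theorem scaled_toeplitz_operator_finite_rank
    (q : ℝ) (hq : 0 < q) (l N : ℕ) (T : Dst) (hT : MemLambdaDual q l T)
    (hP : InfRankLE (matP T) N) (hK : ∀ zs : ℕ → ℂ, InfRankLE (matK T zs) N) :
    ∃ t₀ : ℝ, ∀ t : ℝ, t₀ ≤ t →
      (∃ C : ℝ, ∀ u v : ℂ → ℂ, MemFock u → MemFock v →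
          ‖scaleW t T (fun z => u z * (starRingEnd ℂ) (v z))‖ ≤
            C * fockNorm u * fockNorm v) ∧
      ∃ f g : Fin N → ℂ → ℂ, (∀ j, MemFock (f j)) ∧ (∀ j, MemFock (g j)) ∧
        ∀ u v : ℂ → ℂ, MemFock u → MemFock v →
          scaleW t T (fun z => u z * (starRingEnd ℂ) (v z)) =
            ∑ j : Fin N, fockInner u (g j) * fockInner (f j) v := by
  obtain ⟨a, ha, rfl⟩ : ∃ a : ℝ, 0 < a ∧ q = 8 * a := ⟨q / 8, by positivity, by ring⟩
  obtain ⟨B, hB, hTB⟩ := hT.exists_norm_toeplitzForm_le ha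
  have ha' : 0 < √a := Real.sqrt_pos.2 ha
  refine ⟨4 / √a, fun t ht => ?_⟩
  have ht0 : 0 < t := lt_of_lt_of_le (by positivity) ht
  obtain ⟨s, hs⟩ : ∃ s : ℝ, s = t⁻¹ := ⟨_, rfl⟩
  have hs0 : 0 ≤ s := hs ▸ (inv_pos.2 ht0).le
  have hsa : s ≤ √a / 4 := by
    rw [hs, inv_le_comm₀ ht0 (by positivity), inv_div]
    exact ht
  have hscale : ∀ u v, MemFock u → MemFock v →
      scaleW t T (fun z => u z * (starRingEnd ℂ) (v z)) =
        s * toeplitzForm T (fun z => u (s * z)) (fun z => v (s * z)) := by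
    intro u v hu hv
    rw [hs] at hs0 hsa ⊢
    exact scaleW_mul_conj hT ((hu.expBound_scaled ha hs0 hsa).memLambda ha
      (hv.expBound_scaled ha hs0 hsa) l)
  constructor
  · refine ⟨s * (B * 4), fun u v hu hv => ?_⟩
    rw [hscale u v hu hv, norm_mul, Complex.norm_real, Real.norm_of_nonneg hs0]
    refine (mul_le_mul_of_nonneg_left (hTB (hu.expBound_scaled ha hs0 hsa)
      (hv.expBound_scaled ha hs0 hsa)) hs0).trans (le_of_eq ?_)
    ring
  · obtain ⟨r, hrN, R, C, M, hskel⟩ := hP.exists_skeleton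
    have hmat : ∀ k k', ‖matP T k k'‖ ≤ B * (√(k.factorial : ℝ) * (√a)⁻¹ ^ k) *
        (√(k'.factorial : ℝ) * (√a)⁻¹ ^ k') := fun k k' =>
      hTB (ExpBound.pow ha k) (ExpBound.pow ha k')
    have hleft : ∀ j, ∃ g, MemFock g ∧ ∀ u, MemFock u →
        HasSum (fun k => taylorCoeff u k * ((s : ℂ) ^ k * matP T k (C j))) (fockInner u g) := by
      intro j
      refine exists_memFock_hasSum_fockInner
        (U := B * (√((C j).factorial : ℝ) * (√a)⁻¹ ^ (C j)))
        fun k => norm_pow_mul_le_of_scale ha hs0 hsa ((hmat k (C j)).trans (le_of_eq ?_))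
      ring
    have hright : ∀ j, ∃ f, MemFock f ∧ ∀ v, MemFock v →
        HasSum (fun k' => taylorCoeff v k' *
          ((s : ℂ) ^ k' * (starRingEnd ℂ) (s * ∑ i, M j i * matP T (R i) k')))
          (fockInner v f) := by
      intro j
      refine exists_memFock_hasSum_fockInner
        (U := s * ∑ i, ‖M j i‖ * (B * (√((R i).factorial : ℝ) * (√a)⁻¹ ^ (R i))))
        fun k => norm_pow_mul_le_of_scale ha hs0 hsa ?_
      rw [RCLike.norm_conj, norm_mul, Complex.norm_real, Real.norm_of_nonneg hs0, mul_assoc,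
        Finset.sum_mul]
      refine mul_le_mul_of_nonneg_left (norm_sum_le_of_le _ fun i _ => ?_) hs0
      rw [norm_mul, mul_assoc]
      exact mul_le_mul_of_nonneg_left (hmat _ _) (norm_nonneg _)
    choose g hg hgs using hleft
    choose f hf hfs using hright
    have hrep : ∀ u v, MemFock u → MemFock v →
        scaleW t T (fun z => u z * (starRingEnd ℂ) (v z)) =
          ∑ j, fockInner u (g j) * fockInner (f j) v := by
      intro u v hu hv
      rw [hscale u v hu hv]
      have hlim := (hT.tendsto_sum_matP ha (hu.expBound_scaled ha hs0 hsa).differentiable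
        (hv.expBound_scaled ha hs0 hsa).differentiable (fockNorm_nonneg u) (fockNorm_nonneg v)
        (hu.norm_scaled_coeff_le hs0 hsa) (hv.norm_scaled_coeff_le hs0 hsa)
        (hu.hasSum_scaled s) (hv.hasSum_scaled s)).const_mul (s : ℂ)
      refine tendsto_nhds_unique hlim ?_
      have hlim' := tendsto_finsetSum Finset.univ fun j _ =>
        ((hgs j u hu).tendsto_sum_nat).mul
          ((Complex.hasSum_conj'.2 (hfs j v hv)).tendsto_sum_nat)
      simp_rw [fockInner_conj_symm] at hlim'
      refine hlim'.congr fun K => ?_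
      simp_rw [Finset.sum_mul_sum]
      rw [Finset.sum_comm, Finset.mul_sum]
      refine Finset.sum_congr rfl fun k _ => ?_
      rw [Finset.sum_comm, Finset.mul_sum]
      refine Finset.sum_congr rfl fun k' _ => ?_
      rw [hskel k k', Finset.mul_sum, Finset.mul_sum, Finset.mul_sum]
      refine Finset.sum_congr rfl fun j _ => ?_
      simp only [map_mul, map_pow, Complex.conj_conj, Complex.conj_ofReal]
      ring
    obtain ⟨d, rfl⟩ := Nat.exists_eq_add_of_le hrN
    refine ⟨Fin.append f 0, Fin.append g 0, fun j => ?_, fun j => ?_, fun u v hu hv => ?_⟩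
    · refine Fin.addCases (fun i => ?_) (fun i => ?_) j
      · simpa using hf i
      · simpa using memFock_zero
    · refine Fin.addCases (fun i => ?_) (fun i => ?_) j
      · simpa using hg i
      · simpa using memFock_zero
    · rw [hrep u v hu hv, Fin.sum_univ_add]
      simp [fockInner_zero_left]
end
end

section
/- Let ψ ∈ Λ_{q,l} with q>0 and l≥1. Then for any q'>q, the mollifications ψ_δ = ψ*ρ_δ converge to ψ in Λ_{q',l−1} as δ→0, uniformly in ψ: there is a function τ(δ), independent of ψ, with τ(δ)→0 as δ→0 (one can take τ(δ)=Cδ), such that ‖ψ_δ − ψ‖_{Λ_{q',l−1}} ≤ τ(δ)‖ψ‖_{Λ_{q,l}}. -/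
open MeasureTheory Filter Complex Metric

noncomputable section

/-- `ρ` is a mollifier kernel: smooth, radial, supported in the unit disk, of
integral one. -/
def IsMollifier (ρ : ℂ → ℝ) : Prop :=
  ContDiff ℝ (⊤ : ℕ∞) ρ ∧ (∀ z w : ℂ, ‖z‖ = ‖w‖ → ρ z = ρ w) ∧
    (∀ z : ℂ, 1 < ‖z‖ → ρ z = 0) ∧ (∫ z : ℂ, ρ z) = 1

/-- The mollification `ψ_δ = ψ * ρ_δ`, with `ρ_δ(z) = δ⁻² ρ(z/δ)`. -/
def mollify (ρ : ℂ → ℝ) (δ : ℝ) (ψ : ℂ → ℂ) : ℂ → ℂ := fun z =>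
  ∫ ζ : ℂ, (((δ ^ 2)⁻¹ * ρ (ζ / (δ : ℂ)) : ℝ) : ℂ) * ψ (z - ζ)

section Convolution

universe u

variable {E F : Type u} [NormedAddCommGroup E] [MeasurableSpace E] [BorelSpace E]
  {μ : Measure E} [IsFiniteMeasureOnCompacts μ]
  [NormedAddCommGroup F] [NormedSpace ℝ F]

theorem integrable_smul_comp_sub {k : E → ℝ} (hk : Continuous k) (hkc : HasCompactSupport k)
    {f : E → F} (hf : Continuous f) (x : E) : Integrable (fun t => k t • f (x - t)) μ :=
  (hk.smul (hf.comp (continuous_const.sub continuous_id))).integrable_of_hasCompactSupport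
    hkc.smul_right

variable [NormedSpace ℝ E]

/-- Differentiation of a convolution with a compactly supported kernel, the derivative falling
on the other factor. -/
theorem hasFDerivAt_integral_smul_comp_sub [ProperSpace E] {k : E → ℝ} (hk : Continuous k)
    (hkc : HasCompactSupport k) {f : E → F} (hf : ContDiff ℝ 1 f) (x : E) :
    HasFDerivAt (fun y => ∫ t, k t • f (y - t) ∂μ) (∫ t, k t • fderiv ℝ f (x - t) ∂μ) x := by
  have hf' : Continuous (fderiv ℝ f) := hf.continuous_fderiv one_ne_zero
  obtain ⟨B, hB⟩ := (((isCompact_closedBall x 1).prod hkc).image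
    (continuous_fst.sub continuous_snd)).exists_bound_of_continuousOn hf'.continuousOn
  refine hasFDerivAt_integral_of_dominated_of_fderiv_le (𝕜 := ℝ) (s := closedBall x 1)
    (F' := fun y t => k t • fderiv ℝ f (y - t)) (bound := fun t => ‖k t‖ * B)
    (closedBall_mem_nhds x one_pos)
    (Eventually.of_forall fun y => (integrable_smul_comp_sub hk hkc hf.continuous y).1)
    (integrable_smul_comp_sub hk hkc hf.continuous x)
    (integrable_smul_comp_sub hk hkc hf' x).1
    (Eventually.of_forall fun t y hy => ?_)
    ((hk.integrable_of_hasCompactSupport hkc).norm.mul_const B)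
    (Eventually.of_forall fun t y _ => ?_)
  · rw [norm_smul]
    by_cases ht : t ∈ tsupport k
    · gcongr
      exact hB _ ⟨(y, t), ⟨hy, ht⟩, rfl⟩
    · simp [image_eq_zero_of_notMem_tsupport ht]
  · have h := (hf.differentiable one_ne_zero (y - t)).hasFDerivAt
    exact ((hasFDerivAt_comp_sub t).2 h).const_smul (k t)

theorem norm_integral_smul_comp_sub_sub_le [CompleteSpace F] {k : E → ℝ} (hk : Continuous k)
    (hkc : HasCompactSupport k) {δ : ℝ} (hδ : ∀ t, δ < ‖t‖ → k t = 0) (hk1 : ∫ t, k t ∂μ = 1)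
    {f : E → F} (hf : ContDiff ℝ 1 f) (x : E) {B : ℝ}
    (hB : ∀ w ∈ closedBall x δ, ‖fderiv ℝ f w‖ ≤ B) :
    ‖(∫ t, k t • f (x - t) ∂μ) - f x‖ ≤ (∫ t, ‖k t‖ ∂μ) * (δ * B) := by
  have hki := hk.integrable_of_hasCompactSupport (μ := μ) hkc
  have heq : (∫ t, k t • f (x - t) ∂μ) - f x = ∫ t, k t • (f (x - t) - f x) ∂μ := by
    simp_rw [smul_sub]
    rw [integral_sub (integrable_smul_comp_sub hk hkc hf.continuous x) (hki.smul_const (f x)),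
      integral_smul_const, hk1, one_smul]
  rw [heq, ← integral_mul_const]
  refine norm_integral_le_of_norm_le (hki.norm.mul_const _) (Eventually.of_forall fun t => ?_)
  rw [norm_smul]
  rcases lt_or_ge δ ‖t‖ with ht | ht
  · simp [hδ t ht]
  · have hδ0 : 0 ≤ δ := (norm_nonneg t).trans ht
    have hB0 : 0 ≤ B := (norm_nonneg _).trans (hB x (mem_closedBall_self hδ0))
    gcongr
    have h := (convex_closedBall x δ).norm_image_sub_le_of_norm_fderiv_le (𝕜 := ℝ)
      (fun w _ => hf.differentiable one_ne_zero w) hB (mem_closedBall_self hδ0)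
      (y := x - t) (by simpa [mem_closedBall, dist_eq_norm] using ht)
    rw [sub_sub_cancel_left, norm_neg, mul_comm] at h
    exact h.trans (by gcongr)

/-- Convolution with an approximate identity of radius `δ` moves the `n`-th derivative by at most
`δ` times a local bound of the derivative of order `n + 1`. -/
theorem norm_iteratedFDeriv_integral_smul_comp_sub_sub_le [ProperSpace E] {k : E → ℝ}
    (hk : Continuous k) (hkc : HasCompactSupport k) {δ : ℝ} (hδ : ∀ t, δ < ‖t‖ → k t = 0)
    (hk1 : ∫ t, k t ∂μ = 1) (n : ℕ) {F : Type u} [NormedAddCommGroup F] [NormedSpace ℝ F] [CompleteSpace F]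
    {f : E → F} (hf : ContDiff ℝ (n + 1) f) (x : E) {B : ℝ}
    (hB : ∀ w ∈ closedBall x δ, ‖iteratedFDeriv ℝ (n + 1) f w‖ ≤ B) :
    ‖iteratedFDeriv ℝ n (fun y => (∫ t, k t • f (y - t) ∂μ) - f y) x‖ ≤
      (∫ t, ‖k t‖ ∂μ) * (δ * B) := by
  induction n generalizing F with
  | zero =>
    rw [norm_iteratedFDeriv_zero]
    refine norm_integral_smul_comp_sub_sub_le hk hkc hδ hk1 (by simpa using hf) x fun w hw => ?_
    have h := hB w hw
    rwa [← norm_iteratedFDeriv_fderiv, norm_iteratedFDeriv_zero] at h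
  | succ n ih =>
    have hf1 : ContDiff ℝ 1 f := hf.of_le (by simp)
    have hfd : ContDiff ℝ (n + 1) (fderiv ℝ f) := hf.fderiv_right (by simp)
    have hder : fderiv ℝ (fun y => (∫ t, k t • f (y - t) ∂μ) - f y) =
        fun y => (∫ t, k t • fderiv ℝ f (y - t) ∂μ) - fderiv ℝ f y := by
      ext1 y
      exact ((hasFDerivAt_integral_smul_comp_sub hk hkc hf1 y).sub
        (hf1.differentiable one_ne_zero y).hasFDerivAt).fderiv
    rw [← norm_iteratedFDeriv_fderiv, hder]
    refine ih hfd fun w hw => ?_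
    rw [norm_iteratedFDeriv_fderiv]
    exact hB w hw

end Convolution

theorem Continuous.bddAbove_range_of_tendsto_cocompact {X : Type*} [TopologicalSpace X]
    {f : X → ℝ} (hf : Continuous f) {a : ℝ} (ha : Tendsto f (cocompact X) (nhds a)) :
    BddAbove (Set.range f) := by
  obtain ⟨K, hK, hKf⟩ := mem_cocompact.1 (ha.eventually_le_const (lt_add_one a))
  obtain ⟨B, hB⟩ := hK.bddAbove_image hf.continuousOn
  refine ⟨max B (a + 1), ?_⟩
  rintro _ ⟨x, rfl⟩
  by_cases hx : x ∈ K
  · exact le_max_of_le_left (hB ⟨x, hx, rfl⟩)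
  · exact le_max_of_le_right (hKf hx)

theorem MemLambda.mul_exp_le_lambdaNorm {q : ℝ} {l : ℕ} {ψ : ℂ → ℂ} (h : MemLambda q l ψ)
    {n : ℕ} (hn : n ≤ l) (z : ℂ) :
    ‖iteratedFDeriv ℝ n ψ z‖ * Real.exp (-q * ‖z‖ ^ 2) ≤ lambdaNorm q l ψ := by
  refine le_csSup ?_ ⟨n, hn, z, rfl⟩
  have hb : BddAbove (⋃ m ∈ Set.Iic l, Set.range fun z : ℂ =>
      ‖iteratedFDeriv ℝ m ψ z‖ * Real.exp (-q * ‖z‖ ^ 2)) := by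
    refine ((Set.finite_Iic l).bddAbove_biUnion).2 fun m hm => ?_
    have hc : Continuous (iteratedFDeriv ℝ m ψ) :=
      h.1.continuous_iteratedFDeriv (by exact_mod_cast hm)
    exact Continuous.bddAbove_range_of_tendsto_cocompact (by fun_prop) (h.2 m hm)
  refine hb.mono ?_
  rintro _ ⟨m, hm, w, rfl⟩
  exact Set.mem_biUnion (x := m) hm ⟨w, rfl⟩

theorem MemLambda.lambdaNorm_nonneg {q : ℝ} {l : ℕ} {ψ : ℂ → ℂ} (h : MemLambda q l ψ) :
    0 ≤ lambdaNorm q l ψ :=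
  le_trans (by positivity) (h.mul_exp_le_lambdaNorm l.zero_le 0)

theorem MemLambda.norm_iteratedFDeriv_le {q : ℝ} {l : ℕ} {ψ : ℂ → ℂ} (h : MemLambda q l ψ)
    {n : ℕ} (hn : n ≤ l) (z : ℂ) :
    ‖iteratedFDeriv ℝ n ψ z‖ ≤ lambdaNorm q l ψ * Real.exp (q * ‖z‖ ^ 2) := by
  have := h.mul_exp_le_lambdaNorm hn z
  rwa [neg_mul, Real.exp_neg, ← div_eq_mul_inv, div_le_iff₀ (Real.exp_pos _)] at this

/-- The kernel `ρ_δ`. -/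
def mollifierKernel (ρ : ℂ → ℝ) (δ : ℝ) (ζ : ℂ) : ℝ := (δ ^ 2)⁻¹ * ρ (ζ / (δ : ℂ))

theorem mollify_eq_convolution (ρ : ℂ → ℝ) (δ : ℝ) (ψ : ℂ → ℂ) :
    mollify ρ δ ψ =
      MeasureTheory.convolution (mollifierKernel ρ δ) ψ (ContinuousLinearMap.lsmul ℝ ℝ) volume :=
  rfl

theorem IsMollifier.contDiff_kernel {ρ : ℂ → ℝ} (hρ : IsMollifier ρ) (δ : ℝ) :
    ContDiff ℝ (⊤ : ℕ∞) (mollifierKernel ρ δ) :=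
  contDiff_const.mul (hρ.1.comp (contDiff_id.div_const _))

theorem IsMollifier.kernel_eq_zero {ρ : ℂ → ℝ} (hρ : IsMollifier ρ) {δ : ℝ} (hδ : 0 < δ) {ζ : ℂ}
    (hζ : δ < ‖ζ‖) : mollifierKernel ρ δ ζ = 0 := by
  rw [mollifierKernel, hρ.2.2.1, mul_zero]
  rwa [norm_div, Complex.norm_real, Real.norm_of_nonneg hδ.le, one_lt_div hδ]

theorem IsMollifier.hasCompactSupport_kernel {ρ : ℂ → ℝ} (hρ : IsMollifier ρ) {δ : ℝ}
    (hδ : 0 < δ) : HasCompactSupport (mollifierKernel ρ δ) :=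
  HasCompactSupport.intro (isCompact_closedBall 0 δ) fun ζ hζ =>
    hρ.kernel_eq_zero hδ (by simpa using hζ)

theorem integral_scaled_eq {δ : ℝ} (hδ : 0 < δ) (g : ℂ → ℝ) :
    ∫ ζ : ℂ, (δ ^ 2)⁻¹ * g (ζ / (δ : ℂ)) = ∫ ζ : ℂ, g ζ := by
  have h := Measure.integral_comp_inv_smul_of_nonneg volume g hδ.le
  rw [Complex.finrank_real_complex, smul_eq_mul] at h
  have hsmul : ∀ ζ : ℂ, ζ / (δ : ℂ) = δ⁻¹ • ζ := fun ζ => by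
    rw [Complex.real_smul, Complex.ofReal_inv, div_eq_inv_mul]
  simp_rw [hsmul]
  rw [integral_const_mul, h, inv_mul_cancel_left₀ (by positivity)]

theorem IsMollifier.integral_kernel {ρ : ℂ → ℝ} (hρ : IsMollifier ρ) {δ : ℝ} (hδ : 0 < δ) :
    ∫ ζ, mollifierKernel ρ δ ζ = 1 :=
  (integral_scaled_eq hδ ρ).trans hρ.2.2.2

theorem integral_norm_mollifierKernel (ρ : ℂ → ℝ) {δ : ℝ} (hδ : 0 < δ) :
    ∫ ζ, ‖mollifierKernel ρ δ ζ‖ = ∫ ζ, ‖ρ ζ‖ := by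
  rw [← integral_scaled_eq hδ fun ζ => ‖ρ ζ‖]
  congr 1 with ζ
  rw [mollifierKernel, norm_mul, Real.norm_of_nonneg (by positivity)]

theorem IsMollifier.contDiff_mollify {ρ : ℂ → ℝ} (hρ : IsMollifier ρ) {δ : ℝ} (hδ : 0 < δ)
    {ψ : ℂ → ℂ} (hψ : Continuous ψ) : ContDiff ℝ (⊤ : ℕ∞) (mollify ρ δ ψ) := by
  rw [mollify_eq_convolution]
  exact (hρ.hasCompactSupport_kernel hδ).contDiff_convolution_left _ (hρ.contDiff_kernel δ)
    hψ.locallyIntegrable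

theorem mul_add_one_sq_sub_mul_sq_le {q q' : ℝ} (h : q < q') (r : ℝ) :
    q * (r + 1) ^ 2 - q' * r ^ 2 ≤
      q + 2 * q ^ 2 / (q' - q) - (q' - q) / 2 * r ^ 2 := by
  have hs : 0 < q' - q := sub_pos.2 h
  have hsq : q + 2 * q ^ 2 / (q' - q) - (q' - q) / 2 * r ^ 2 - (q * (r + 1) ^ 2 - q' * r ^ 2) =
      ((q' - q) * r - 2 * q) ^ 2 / (2 * (q' - q)) := by
    field_simp
    ring
  exact sub_nonneg.1 (hsq ▸ by positivity)

/-- The pointwise Gaussian estimate for the mollification error. -/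
theorem IsMollifier.norm_iteratedFDeriv_mollify_sub_mul_exp_le {q q' : ℝ} (hq : 0 < q)
    (hqq' : q < q') {l : ℕ} {ρ : ℂ → ℝ} (hρ : IsMollifier ρ) {δ : ℝ} (hδ : 0 < δ) (hδ1 : δ ≤ 1)
    {ψ : ℂ → ℂ} (hψ : MemLambda q l ψ) {n : ℕ} (hn : n + 1 ≤ l) (z : ℂ) :
    ‖iteratedFDeriv ℝ n (mollify ρ δ ψ - ψ) z‖ * Real.exp (-q' * ‖z‖ ^ 2) ≤
      (∫ ζ, ‖ρ ζ‖) * Real.exp (q + 2 * q ^ 2 / (q' - q)) * δ * lambdaNorm q l ψ *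
        Real.exp (-((q' - q) / 2 * ‖z‖ ^ 2)) := by
  have hN := hψ.lambdaNorm_nonneg
  have hM : 0 ≤ ∫ ζ, ‖ρ ζ‖ := integral_nonneg fun _ => norm_nonneg _
  have hB : ∀ w ∈ closedBall z δ, ‖iteratedFDeriv ℝ (n + 1) ψ w‖ ≤
      lambdaNorm q l ψ * Real.exp (q * (‖z‖ + 1) ^ 2) := fun w hw => by
    refine (hψ.norm_iteratedFDeriv_le hn w).trans ?_
    have hwz : ‖w‖ ≤ ‖z‖ + 1 :=
      (norm_le_norm_add_norm_sub' w z).trans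
        (by gcongr; exact (mem_closedBall_iff_norm.1 hw).trans hδ1)
    gcongr
  have hsm : ContDiff ℝ (n + 1) ψ := hψ.1.of_le (by exact_mod_cast hn)
  have h := norm_iteratedFDeriv_integral_smul_comp_sub_sub_le (hρ.contDiff_kernel δ).continuous
    (hρ.hasCompactSupport_kernel hδ) (fun _ => hρ.kernel_eq_zero hδ) (hρ.integral_kernel hδ) n
    hsm z hB
  rw [integral_norm_mollifierKernel ρ hδ] at h
  calc ‖iteratedFDeriv ℝ n (mollify ρ δ ψ - ψ) z‖ * Real.exp (-q' * ‖z‖ ^ 2)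
      ≤ (∫ ζ, ‖ρ ζ‖) * (δ * (lambdaNorm q l ψ * Real.exp (q * (‖z‖ + 1) ^ 2))) *
          Real.exp (-q' * ‖z‖ ^ 2) := by
        gcongr
        exact h
    _ = (∫ ζ, ‖ρ ζ‖) * δ * lambdaNorm q l ψ *
          Real.exp (q * (‖z‖ + 1) ^ 2 - q' * ‖z‖ ^ 2) := by
        rw [sub_eq_add_neg, Real.exp_add, ← neg_mul]
        ring
    _ ≤ (∫ ζ, ‖ρ ζ‖) * δ * lambdaNorm q l ψ *
          Real.exp (q + 2 * q ^ 2 / (q' - q) - (q' - q) / 2 * ‖z‖ ^ 2) := by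
        exact mul_le_mul_of_nonneg_left
          (Real.exp_le_exp.2 (mul_add_one_sq_sub_mul_sq_le hqq' ‖z‖)) (by positivity)
    _ = _ := by
        rw [sub_eq_add_neg, Real.exp_add]
        ring

/-- **Convergence of mollifications in the weighted classes (functions).**
For `ψ ∈ Λ_{q,l}` (`l ≥ 1`) and `q' > q`, the mollifications `ψ_δ` converge to `ψ`
in `Λ_{q',l-1}` as `δ → 0`, uniformly in `ψ`: one can take `τ(δ) = Cδ`. -/
theorem mollification_converges_in_lambda
    (q q' : ℝ) (hq : 0 < q) (hqq' : q < q') (l : ℕ) (hl : 1 ≤ l)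
    (ρ : ℂ → ℝ) (hρ : IsMollifier ρ) :
    ∃ C : ℝ, ∀ δ : ℝ, 0 < δ → δ ≤ 1 → ∀ ψ : ℂ → ℂ, MemLambda q l ψ →
      MemLambda q' (l - 1) (mollify ρ δ ψ - ψ) ∧
      ∀ n : ℕ, n ≤ l - 1 → ∀ z : ℂ,
        ‖iteratedFDeriv ℝ n (mollify ρ δ ψ - ψ) z‖ * Real.exp (-q' * ‖z‖ ^ 2) ≤
          C * δ * lambdaNorm q l ψ := by
  refine ⟨(∫ ζ, ‖ρ ζ‖) * Real.exp (q + 2 * q ^ 2 / (q' - q)), fun δ hδ hδ1 ψ hψ => ?_⟩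
  have hs : 0 < (q' - q) / 2 := by linarith
  have key := fun (n : ℕ) (hn : n ≤ l - 1) (z : ℂ) =>
    hρ.norm_iteratedFDeriv_mollify_sub_mul_exp_le hq hqq' hδ hδ1 hψ
      (show n + 1 ≤ l by omega) z
  refine ⟨⟨?_, fun n hn => ?_⟩, fun n hn z => (key n hn z).trans ?_⟩
  · exact ((hρ.contDiff_mollify hδ hψ.1.continuous).of_le (by exact_mod_cast le_top)).sub
      (hψ.1.of_le (by exact_mod_cast l.sub_le 1))
  · refine squeeze_zero (fun z => by positivity) (key n hn) ?_
    have hsq : Tendsto (fun z : ℂ => (q' - q) / 2 * ‖z‖ ^ 2) (cocompact ℂ) atTop :=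
      ((tendsto_pow_atTop two_ne_zero).comp tendsto_norm_cocompact_atTop).const_mul_atTop hs
    simpa using (Real.tendsto_exp_neg_atTop_nhds_zero.comp hsq).const_mul _
  · have hM : 0 ≤ ∫ ζ, ‖ρ ζ‖ := integral_nonneg fun _ => norm_nonneg _
    have hN := hψ.lambdaNorm_nonneg
    refine mul_le_of_le_one_right (by positivity) (Real.exp_le_one_iff.2 ?_)
    exact neg_nonpos.2 (by positivity)
end
end
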